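/- arXiv:2405.04004 — 2 statements merged into one kernel-verified Lean document; each statement's English description precedes it below -/
import Mathlib

section
/- Let k_1, k_2 be positive integers. Let b_n be the number of sequences of length n over {1,2} that end with the pattern (k_1,k_2), let b'_n be the number of sequences of length n ≥ 1 over {1,2} that do not end with the pattern (k_1,k_2), and set H̃_2(z) = Σ_{n≥1} b_n z^n and H̃_2'(z) = Σ_{n≥1} b'_n z^n, formal power series over ℤ. Then H̃_2(z) · (1 − z)(1 − 2z) = z^{k_1+k_2} and H̃_2'(z) · (1 − z)(1 − 2z) = 2z(1 − z) − z^{k_1+k_2}. -/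
/-- States are `Fin ℓ`, with the element of value `i` (0-based) playing the role of the
state `i+1` of the informal statement.  `OccursAt ℓ n k s j0` says that an occurrence of
the pattern `(k 0, …, k (ℓ-1))` starts at position `j0` in the sequence `s`:
there are `0 ≤ j0 < j1 < ⋯ < jℓ ≤ n` with `j_{i+1} - j_i ≥ k i`, all letters in the
`i`-th block equal to `i`, and either `j0 = 0` or the letter before `j0` differs from
the first state. -/
def OccursAt (ℓ n : ℕ) (k : Fin ℓ → ℕ) (s : Fin n → Fin ℓ) (j0 : ℕ) : Prop :=
  ∃ j : ℕ → ℕ, j 0 = j0 ∧ j ℓ ≤ n ∧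
    (∀ i : Fin ℓ, j i.val + k i ≤ j (i.val + 1)) ∧
    (∀ i : Fin ℓ, ∀ t : ℕ, ∀ ht : t < n,
      j i.val ≤ t → t < j (i.val + 1) → (s ⟨t, ht⟩ : ℕ) = i.val) ∧
    (j0 = 0 ∨ ∃ h : j0 - 1 < n, (s ⟨j0 - 1, h⟩ : ℕ) ≠ 0)

/-- The pattern count `X(s)`: the number of positions at which an occurrence of the
pattern `(k 0, …, k (ℓ-1))` starts. -/
noncomputable def patCount (ℓ n : ℕ) (k : Fin ℓ → ℕ) (s : Fin n → Fin ℓ) : ℕ :=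
  {j0 : ℕ | OccursAt ℓ n k s j0}.ncard

/-- `s` ends with the pattern `(k 0, …, k (ℓ-1))`: it has a suffix
`0^{a_0} 1^{a_1} ⋯ (ℓ-1)^{a_{ℓ-1}}` with `a_i ≥ k i`. -/
def EndsWith (ℓ n : ℕ) (k : Fin ℓ → ℕ) (s : Fin n → Fin ℓ) : Prop :=
  ∃ j : ℕ → ℕ, j ℓ = n ∧
    (∀ i : Fin ℓ, j i.val + k i ≤ j (i.val + 1)) ∧
    (∀ i : Fin ℓ, ∀ t : ℕ, ∀ ht : t < n,
      j i.val ≤ t → t < j (i.val + 1) → (s ⟨t, ht⟩ : ℕ) = i.val)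

/-- The weight of a sequence `s`: the product of the probabilities of its letters. -/
def wt (ℓ n : ℕ) (p : Fin ℓ → ℝ) (s : Fin n → Fin ℓ) : ℝ := ∏ t, p (s t)

/-- `F_{ℓ,n}(w) = Σ_{m≥0} P_{ℓ,n}(m) w^m ∈ ℝ[w]`, where `P_{ℓ,n}(m)` is the total weight
of the sequences of length `n` with pattern count `m`; equivalently
`F_{ℓ,n}(w) = Σ_s weight(s) · w^{X(s)}`. -/
noncomputable def Fpoly (ℓ n : ℕ) (k : Fin ℓ → ℕ) (p : Fin ℓ → ℝ) : Polynomial ℝ :=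
  ∑ s : Fin n → Fin ℓ, Polynomial.C (wt ℓ n p s) * Polynomial.X ^ patCount ℓ n k s

/-- `b_n`: the number of sequences of length `n` that end with the pattern. -/
noncomputable def endCount (ℓ n : ℕ) (k : Fin ℓ → ℕ) : ℕ :=
  {s : Fin n → Fin ℓ | EndsWith ℓ n k s}.ncard

/-- `b'_n` (for `n ≥ 1`): the number of sequences of length `n` that do NOT end with the
pattern; the value at `n = 0` is set to `0` since the sum starts at `n = 1`. -/
noncomputable def endCount' (ℓ n : ℕ) (k : Fin ℓ → ℕ) : ℕ :=
  if n = 0 then 0 else {s : Fin n → Fin ℓ | ¬ EndsWith ℓ n k s}.ncard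

/-- The words of length `n` over two letters which equal `0` on `[d, d + k₁)`, equal `1` on
`[d + k₁, n)`, and are arbitrary below `d`. -/
def blockWords (n k₁ d : ℕ) : Finset (Fin n → Fin 2) :=
  Fintype.piFinset fun t : Fin n =>
    if (t : ℕ) < d then Finset.univ else if (t : ℕ) < d + k₁ then {0} else {1}

theorem mem_blockWords {n k₁ d : ℕ} {s : Fin n → Fin 2} :
    s ∈ blockWords n k₁ d ↔
      ∀ t : Fin n, d ≤ t → ((t : ℕ) < d + k₁ → s t = 0) ∧ (d + k₁ ≤ t → s t = 1) := by
  simp only [blockWords, Fintype.mem_piFinset]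
  refine forall_congr' fun t => ?_
  split_ifs with h₁ h₂
  · simp [h₁]
  · simp [h₂, not_lt.mp h₁]
  · simp [h₂, not_lt.mp h₁, not_lt.mp h₂]

theorem card_blockWords {n k₁ d : ℕ} (hd : d ≤ n) : (blockWords n k₁ d).card = 2 ^ d := by
  have h : ∀ t : Fin n, (if (t : ℕ) < d then Finset.univ else
      if (t : ℕ) < d + k₁ then {0} else {1} : Finset (Fin 2)).card =
        if (t : ℕ) < d then 2 else 1 := by
    intro t
    split_ifs <;> simp
  rw [blockWords, Fintype.card_piFinset, Finset.prod_congr rfl fun t _ => h t,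
    Finset.prod_ite, Finset.prod_const, Finset.prod_const_one, mul_one, Fin.card_filter_val_lt,
    min_eq_right hd]

theorem endsWith_two_iff {n k₁ k₂ : ℕ} {s : Fin n → Fin 2} :
    EndsWith 2 n ![k₁, k₂] s ↔ ∃ d < n + 1 - (k₁ + k₂), s ∈ blockWords n k₁ d := by
  simp only [mem_blockWords]
  constructor
  · rintro ⟨j, hn, hk, hs⟩
    have hk0 := hk 0
    have hk1 := hk 1
    have hs0 := hs 0
    have hs1 := hs 1
    simp only [Fin.val_zero, Fin.val_one, Matrix.cons_val_zero, Matrix.cons_val_one,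
      zero_add, one_add_one_eq_two] at hk0 hk1 hs0 hs1
    refine ⟨j 1 - k₁, by omega, fun t ht => ⟨fun h => Fin.ext ?_, fun h => Fin.ext ?_⟩⟩
    · exact hs0 t t.2 (by omega) (by omega)
    · exact hs1 t t.2 (by omega) (by omega)
  · rintro ⟨d, hd, hs⟩
    refine ⟨fun i => if i = 0 then d else if i = 1 then d + k₁ else n, by simp, ?_, ?_⟩
    · rw [Fin.forall_fin_two]
      simp
      omega
    · rw [Fin.forall_fin_two]
      simp only [Fin.val_zero, Fin.val_one]
      refine ⟨fun t ht h₁ h₂ => ?_, fun t ht h₁ h₂ => ?_⟩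
      · simp at h₁ h₂
        simp [(hs ⟨t, ht⟩ h₁).1 h₂]
      · simp at h₁ h₂
        simp [(hs ⟨t, ht⟩ (show d ≤ t by omega)).2 h₁]

theorem disjoint_blockWords {n k₁ d e : ℕ} (hk₁ : 0 < k₁) (hde : d < e) (he : e + k₁ ≤ n) :
    Disjoint (blockWords n k₁ d) (blockWords n k₁ e) := by
  rw [Finset.disjoint_left]
  intro s hs hs'
  rw [mem_blockWords] at hs hs'
  have hlt : e + k₁ - 1 < n := by omega
  have h₁ := (hs ⟨e + k₁ - 1, hlt⟩ (show d ≤ e + k₁ - 1 by omega)).2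
    (show d + k₁ ≤ e + k₁ - 1 by omega)
  have h₀ := (hs' ⟨e + k₁ - 1, hlt⟩ (show e ≤ e + k₁ - 1 by omega)).1
    (show e + k₁ - 1 < e + k₁ by omega)
  simp [h₁] at h₀

theorem endCount_two_add_one {n k₁ k₂ : ℕ} (hk₁ : 0 < k₁) :
    endCount 2 n ![k₁, k₂] + 1 = 2 ^ (n + 1 - (k₁ + k₂)) := by
  have hset : {s : Fin n → Fin 2 | EndsWith 2 n ![k₁, k₂] s} =
      ((Finset.range (n + 1 - (k₁ + k₂))).biUnion (blockWords n k₁) :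
        Finset (Fin n → Fin 2)) := by
    ext s
    simp [endsWith_two_iff]
  rw [endCount, hset, Set.ncard_coe_finset, Finset.card_biUnion]
  · rw [Finset.sum_congr rfl fun d hd =>
      card_blockWords (by have := Finset.mem_range.mp hd; omega), Nat.geomSum_eq le_rfl]
    have := Nat.one_le_two_pow (n := n + 1 - (k₁ + k₂))
    simp
    omega
  · intro d hd e he hne
    have hd := Finset.mem_range.mp hd
    have he := Finset.mem_range.mp he
    rcases lt_or_gt_of_ne hne with h | h
    · exact disjoint_blockWords hk₁ h (by omega)
    · exact (disjoint_blockWords hk₁ h (by omega)).symm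

theorem endCount_add_endCount' {ℓ n : ℕ} (k : Fin ℓ → ℕ) (hn : n ≠ 0) :
    endCount ℓ n k + endCount' ℓ n k = ℓ ^ n := by
  rw [endCount, endCount', if_neg hn, ← Set.compl_ofPred, Set.ncard_add_ncard_compl]
  simp

theorem mk_two_pow_mul_one_sub :
    (PowerSeries.mk fun n => (2 : ℤ) ^ n) * (1 - 2 * PowerSeries.X) = 1 := by
  rw [mul_sub, mul_one, mul_left_comm, two_mul]
  ext n
  cases n with
  | zero => simp
  | succ n => simp [PowerSeries.coeff_succ_mul_X, PowerSeries.coeff_one, pow_succ, mul_two]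

theorem mk_endCount_two {k₁ k₂ : ℕ} (hk₁ : 0 < k₁) :
    (PowerSeries.mk fun n => (endCount 2 n ![k₁, k₂] : ℤ)) =
      PowerSeries.X ^ (k₁ + k₂) *
        (2 * (PowerSeries.mk fun n => (2 : ℤ) ^ n) - PowerSeries.mk 1) := by
  rw [two_mul]
  ext n
  have h : (endCount 2 n ![k₁, k₂] : ℤ) = 2 ^ (n + 1 - (k₁ + k₂)) - 1 := by
    rw [eq_sub_iff_add_eq]
    exact_mod_cast endCount_two_add_one hk₁
  rw [PowerSeries.coeff_mk, h, PowerSeries.coeff_X_pow_mul']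
  split_ifs with hle
  · simp [Nat.sub_add_comm hle, pow_succ, mul_two]
  · simp [show n + 1 - (k₁ + k₂) = 0 by omega]

theorem mk_endCount'_two {k₁ k₂ : ℕ} (hk₁ : 0 < k₁) (hk₂ : 0 < k₂) :
    (PowerSeries.mk fun n => (endCount' 2 n ![k₁, k₂] : ℤ)) =
      (PowerSeries.mk fun n => (2 : ℤ) ^ n) - 1 -
        PowerSeries.mk fun n => (endCount 2 n ![k₁, k₂] : ℤ) := by
  ext n
  rcases eq_or_ne n 0 with rfl | hn
  · have h := endCount_two_add_one (n := 0) (k₂ := k₂) hk₁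
    rw [show 0 + 1 - (k₁ + k₂) = 0 by omega] at h
    simp [endCount', show endCount 2 0 ![k₁, k₂] = 0 by simpa using h]
  · have h : (endCount 2 n ![k₁, k₂] : ℤ) + endCount' 2 n ![k₁, k₂] = 2 ^ n := by
      exact_mod_cast endCount_add_endCount' ![k₁, k₂] hn
    simp [PowerSeries.coeff_one, hn, ← h]

theorem statement16 (k₁ k₂ : ℕ) (hk₁ : 0 < k₁) (hk₂ : 0 < k₂) :
    (PowerSeries.mk fun n => (endCount 2 n ![k₁, k₂] : ℤ)) *
        ((1 - PowerSeries.X) * (1 - 2 * PowerSeries.X)) =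
      PowerSeries.X ^ (k₁ + k₂) ∧
    (PowerSeries.mk fun n => (endCount' 2 n ![k₁, k₂] : ℤ)) *
        ((1 - PowerSeries.X) * (1 - 2 * PowerSeries.X)) =
      2 * PowerSeries.X * (1 - PowerSeries.X) - PowerSeries.X ^ (k₁ + k₂) := by
  have hP := mk_two_pow_mul_one_sub
  have hQ := PowerSeries.mk_one_mul_one_sub_eq_one ℤ
  have hH : (PowerSeries.mk fun n => (endCount 2 n ![k₁, k₂] : ℤ)) *
      ((1 - PowerSeries.X) * (1 - 2 * PowerSeries.X)) = PowerSeries.X ^ (k₁ + k₂) := by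
    rw [mk_endCount_two hk₁]
    linear_combination PowerSeries.X ^ (k₁ + k₂) *
      (2 * (1 - PowerSeries.X) * hP - (1 - 2 * PowerSeries.X) * hQ)
  refine ⟨hH, ?_⟩
  rw [mk_endCount'_two hk₁ hk₂]
  linear_combination (1 - PowerSeries.X) * hP - hH
end

section
/- Let ℓ = 3 and let k_1, k_2, k_3 be positive integers with k = k_1+k_2+k_3. Then for all n ≥ k, the total number of occurrences of the pattern (k_1,k_2,k_3) over all 3^n sequences of length n over {1,2,3} satisfies Σ_{s} X(s) = 1/4 + (1 + 2n − 2k)·3^{n−k+1}/4; equivalently, the expected pattern count under the uniform distribution on sequences of length n is 3^{−n}·[1/4 + (1 + 2n − 2k)·3^{n−k+1}/4]. -/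
/-- The letters allowed at position `t` for an occurrence whose three blocks are
`[z, a)`, `[a, b)` and `[b, c)`, the first block being preceded by a nonzero letter. -/
def allowedLetters (z a b c t : ℕ) : Finset (Fin 3) :=
  if t + 1 < z then Finset.univ
  else if t + 1 = z then {1, 2}
  else if t < a then {0}
  else if t < b then {1}
  else if t < c then {2}
  else Finset.univ

/-- The sequences of length `n` with blocks `[z, a)`, `[a, b)` and `[b, c)`. -/
def blockSeqs (n z a b c : ℕ) : Finset (Fin n → Fin 3) :=
  Fintype.piFinset fun t : Fin n => allowedLetters z a b c t

/-- The number of words of length `z` that are empty or end with a nonzero letter. -/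
def headWeight (z : ℕ) : ℕ := if z = 0 then 1 else 2 * 3 ^ (z - 1)

lemma card_blockSeqs (z u d a b : ℕ) (ha : a ≤ z + d) (hb : b ≤ z + d) :
    (blockSeqs (z + d + u) z a b (z + d)).card = headWeight z * 3 ^ u := by
  have hpre : ∏ t ∈ Finset.range z, (allowedLetters z a b (z + d) t).card =
      headWeight z := by
    rcases z with _ | z
    · simp [headWeight]
    · rw [Finset.prod_range_succ, Finset.prod_congr rfl (g := fun _ => 3)]
      · simp [headWeight, allowedLetters, mul_comm]
      · intro t ht
        have : t + 1 < z + 1 := by simpa using ht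
        simp only [allowedLetters, if_pos this]
        rfl
  have hmid : ∏ t ∈ Finset.range d, (allowedLetters z a b (z + d) (z + t)).card = 1 := by
    refine Finset.prod_eq_one fun t ht => ?_
    have ht : t < d := by simpa using ht
    unfold allowedLetters
    rw [if_neg (by omega), if_neg (by omega)]
    split_ifs <;> first | rfl | omega
  have hsuf : ∏ t ∈ Finset.range u, (allowedLetters z a b (z + d) (z + d + t)).card =
      3 ^ u := by
    rw [Finset.prod_congr rfl (g := fun _ => 3)]
    · simp
    · intro t _
      unfold allowedLetters
      rw [if_neg (by omega), if_neg (by omega), if_neg (by omega), if_neg (by omega),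
        if_neg (by omega)]
      rfl
  rw [blockSeqs, Fintype.card_piFinset,
    Fin.prod_univ_eq_prod_range (fun t => (allowedLetters z a b (z + d) t).card),
    Finset.prod_range_add, Finset.prod_range_add, hpre, hmid, hsuf, mul_one]

lemma mem_blockSeqs {n z a b c : ℕ} (hza : z ≤ a) (hab : a ≤ b) (hbc : b ≤ c)
    {s : Fin n → Fin 3} :
    s ∈ blockSeqs n z a b c ↔ ∀ t (ht : t < n),
      (z ≤ t → t < a → (s ⟨t, ht⟩ : ℕ) = 0) ∧ (a ≤ t → t < b → (s ⟨t, ht⟩ : ℕ) = 1) ∧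
      (b ≤ t → t < c → (s ⟨t, ht⟩ : ℕ) = 2) ∧ (t + 1 = z → (s ⟨t, ht⟩ : ℕ) ≠ 0) := by
  rw [blockSeqs, Fintype.mem_piFinset, Fin.forall_iff]
  refine forall_congr' fun t => forall_congr' fun ht => ?_
  generalize s ⟨t, ht⟩ = x
  dsimp only
  unfold allowedLetters
  split_ifs <;> fin_cases x <;> simp <;> omega

lemma occursAt_three_iff {n k₁ k₂ k₃ z : ℕ} {s : Fin n → Fin 3} :
    OccursAt 3 n ![k₁, k₂, k₃] s z ↔
      ∃ a b, z + k₁ ≤ a ∧ a + k₂ ≤ b ∧ b + k₃ ≤ n ∧ s ∈ blockSeqs n z a b (b + k₃) := by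
  constructor
  · rintro ⟨j, rfl, h3, hk, hs, hz⟩
    have h0 := hk 0
    have h1 := hk 1
    have h2 := hk 2
    simp at h0 h1 h2
    refine ⟨j 1, j 2, h0, h1, by omega, ?_⟩
    rw [mem_blockSeqs (by omega) (by omega) (by omega)]
    intro t ht
    refine ⟨fun p q => hs 0 t ht p q, fun p q => hs 1 t ht p q,
      fun p q => hs 2 t ht p (by simp; omega), fun p => ?_⟩
    rcases hz with hz | ⟨h, hz⟩
    · omega
    · have : j 0 - 1 = t := by omega
      simpa [this] using hz
  · rintro ⟨a, b, h0, h1, h2, hs⟩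
    rw [mem_blockSeqs (by omega) (by omega) (by omega)] at hs
    refine ⟨fun i => if i = 0 then z else if i = 1 then a else if i = 2 then b else b + k₃,
      rfl, h2, ?_, ?_, ?_⟩
    · intro i
      fin_cases i <;> simp <;> omega
    · intro i t ht p q
      have := hs t ht
      fin_cases i
      · exact this.1 p q
      · exact this.2.1 p q
      · exact this.2.2.1 p q
    · rcases Nat.eq_zero_or_pos z with hz | hz
      · exact .inl hz
      · exact .inr ⟨by omega, (hs (z - 1) (by omega)).2.2.2 (by omega)⟩

lemma blockSeqs_inj {n z a b a' b' k₃ : ℕ} {s : Fin n → Fin 3} (hk₃ : 0 < k₃)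
    (hza : z ≤ a) (hab : a < b) (hbn : b + k₃ ≤ n)
    (hza' : z ≤ a') (hab' : a' < b') (hbn' : b' + k₃ ≤ n)
    (hs : s ∈ blockSeqs n z a b (b + k₃)) (hs' : s ∈ blockSeqs n z a' b' (b' + k₃)) :
    a = a' ∧ b = b' := by
  rw [mem_blockSeqs (by omega) (by omega) (by omega)] at hs hs'
  have haa : a = a' := by
    have h := hs a (by omega)
    have h' := hs' a (by omega)
    have g := hs a' (by omega)
    have g' := hs' a' (by omega)
    omega
  subst haa
  have h := hs b (by omega)
  have h' := hs' b (by omega)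
  have g := hs b' (by omega)
  have g' := hs' b' (by omega)
  omega

/-- The triples `(i, h, z)` with `z ≤ h ≤ i ≤ m`. -/
def descTriples (m : ℕ) : Finset (Σ _ : ℕ, Σ _ : ℕ, ℕ) :=
  (Finset.range (m + 1)).sigma fun i => (Finset.range (i + 1)).sigma fun h =>
    Finset.range (h + 1)

lemma mem_descTriples {m i h z : ℕ} :
    (⟨i, h, z⟩ : Σ _ : ℕ, Σ _ : ℕ, ℕ) ∈ descTriples m ↔ i ≤ m ∧ h ≤ i ∧ z ≤ h := by
  simp [descTriples]

lemma sum_headWeight (h : ℕ) :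
    (∑ z ∈ Finset.range (h + 1), ((headWeight z * 3 ^ (h - z) : ℕ) : ℝ)) =
      3 ^ h + 2 * h * 3 ^ h / 3 := by
  rw [Finset.sum_range_succ', Finset.sum_congr rfl (g := fun _ => (2 * 3 ^ h / 3 : ℝ))]
  · simp [headWeight]
    ring
  · intro z hz
    obtain ⟨d, rfl⟩ := Nat.exists_eq_add_of_lt (Finset.mem_range.1 hz)
    have : z + d + 1 - (z + 1) = d := by omega
    rw [this]
    simp [headWeight]
    ring

lemma sum_descTriples (m : ℕ) :
    (∑ x ∈ descTriples m, ((headWeight x.2.2 * 3 ^ (x.2.1 - x.2.2) : ℕ) : ℝ)) =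
      1 / 4 + (1 + 2 * (m : ℝ)) * 3 ^ (m + 1) / 4 := by
  have hB (i : ℕ) : ∑ h ∈ Finset.range (i + 1), ((3 : ℝ) ^ h + 2 * h * 3 ^ h / 3) =
      (i + 1) * 3 ^ i := by
    induction i with
    | zero => simp
    | succ i ih => rw [Finset.sum_range_succ, ih]; push_cast; ring
  have hT : ∑ i ∈ Finset.range (m + 1), ((i : ℝ) + 1) * 3 ^ i =
      1 / 4 + (1 + 2 * (m : ℝ)) * 3 ^ (m + 1) / 4 := by
    induction m with
    | zero => norm_num
    | succ m ih => rw [Finset.sum_range_succ, ih]; push_cast; ring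
  rw [descTriples, Finset.sum_sigma, ← hT]
  refine Finset.sum_congr rfl fun i _ => ?_
  rw [Finset.sum_sigma, ← hB]
  exact Finset.sum_congr rfl fun h _ => sum_headWeight h

/-- The sequences of length `k₁ + k₂ + k₃ + m` with an occurrence starting at `z`, whose
first block ends at `z + k₁ + (m - i)` and whose second block has length `k₂ + (i - h)`. -/
def tripleSeqs (k₁ k₂ k₃ m : ℕ) (x : Σ _ : ℕ, Σ _ : ℕ, ℕ) :
    Finset (Fin (k₁ + k₂ + k₃ + m) → Fin 3) :=
  blockSeqs _ x.2.2 (x.2.2 + k₁ + (m - x.1)) (x.2.2 + k₁ + (m - x.1) + k₂ + (x.1 - x.2.1))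
    (x.2.2 + k₁ + (m - x.1) + k₂ + (x.1 - x.2.1) + k₃)

lemma card_tripleSeqs (k₁ k₂ k₃ m : ℕ) {x : Σ _ : ℕ, Σ _ : ℕ, ℕ}
    (hx : x ∈ descTriples m) :
    (tripleSeqs k₁ k₂ k₃ m x).card = headWeight x.2.2 * 3 ^ (x.2.1 - x.2.2) := by
  obtain ⟨i, h, z⟩ := x
  obtain ⟨hi, hh, hz⟩ := mem_descTriples.1 hx
  have := card_blockSeqs z (h - z) (k₁ + (m - i) + k₂ + (i - h) + k₃)
    (z + k₁ + (m - i)) (z + k₁ + (m - i) + k₂ + (i - h)) (by omega) (by omega)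
  rw [← this, tripleSeqs]
  have hn : k₁ + k₂ + k₃ + m = z + (k₁ + (m - i) + k₂ + (i - h) + k₃) + (h - z) := by omega
  rw [hn]
  simp only [← add_assoc]

lemma patCount_three_eq_card (k₁ k₂ k₃ m : ℕ) (hk₂ : 0 < k₂) (hk₃ : 0 < k₃)
    (s : Fin (k₁ + k₂ + k₃ + m) → Fin 3) :
    patCount 3 (k₁ + k₂ + k₃ + m) ![k₁, k₂, k₃] s =
      ((descTriples m).filter fun x => s ∈ tripleSeqs k₁ k₂ k₃ m x).card := by
  have himage : {z | OccursAt 3 (k₁ + k₂ + k₃ + m) ![k₁, k₂, k₃] s z} =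
      (((descTriples m).filter fun x => s ∈ tripleSeqs k₁ k₂ k₃ m x).image
        fun x => x.2.2 : Finset ℕ) := by
    ext z
    rw [Set.mem_ofPred_eq, occursAt_three_iff, Finset.mem_coe, Finset.mem_image]
    constructor
    · rintro ⟨a, b, ha, hb, hn, hs⟩
      obtain ⟨p, rfl⟩ := Nat.exists_eq_add_of_le ha
      obtain ⟨q, rfl⟩ := Nat.exists_eq_add_of_le hb
      refine ⟨⟨m - p, m - p - q, z⟩,
        Finset.mem_filter.2 ⟨mem_descTriples.2 ⟨by omega, by omega, by omega⟩, ?_⟩, rfl⟩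
      have hp : m - (m - p) = p := by omega
      have hq : m - p - (m - p - q) = q := by omega
      simpa only [tripleSeqs, hp, hq] using hs
    · rintro ⟨⟨i, h, y⟩, hx, rfl⟩
      obtain ⟨hx, hs⟩ := Finset.mem_filter.1 hx
      have := mem_descTriples.1 hx
      exact ⟨_, _, by dsimp only; omega, by dsimp only; omega, by dsimp only; omega, hs⟩
  rw [patCount, himage, Set.ncard_coe_finset, Finset.card_image_of_injOn]
  rintro ⟨i, h, z⟩ hx ⟨i', h', z'⟩ hx' hz
  obtain rfl : z = z' := hz
  obtain ⟨hx, hs⟩ := Finset.mem_filter.1 hx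
  obtain ⟨hx', hs'⟩ := Finset.mem_filter.1 hx'
  have hm := mem_descTriples.1 hx
  have hm' := mem_descTriples.1 hx'
  have hab := blockSeqs_inj hk₃ (by dsimp only; omega) (by dsimp only; omega)
    (by dsimp only; omega) (by dsimp only; omega) (by dsimp only; omega)
    (by dsimp only; omega) hs hs'
  dsimp only at hab
  obtain rfl : i = i' := by omega
  obtain rfl : h = h' := by omega
  rfl

theorem statement18 (k₁ k₂ k₃ : ℕ) (hk₁ : 0 < k₁) (hk₂ : 0 < k₂) (hk₃ : 0 < k₃)
    (n : ℕ) (hn : k₁ + k₂ + k₃ ≤ n) :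
    (∑ s : Fin n → Fin 3, (patCount 3 n ![k₁, k₂, k₃] s : ℝ)) =
      1 / 4 + (1 + 2 * (n : ℝ) - 2 * ((k₁ : ℝ) + k₂ + k₃)) *
        3 ^ (n - (k₁ + k₂ + k₃) + 1) / 4 := by
  obtain ⟨m, rfl⟩ := Nat.exists_eq_add_of_le hn
  have hsum : ∑ s, patCount 3 (k₁ + k₂ + k₃ + m) ![k₁, k₂, k₃] s =
      ∑ x ∈ descTriples m, headWeight x.2.2 * 3 ^ (x.2.1 - x.2.2) := by
    simp_rw [patCount_three_eq_card k₁ k₂ k₃ m hk₂ hk₃, Finset.card_filter]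
    rw [Finset.sum_comm]
    refine Finset.sum_congr rfl fun x hx => ?_
    rw [← card_tripleSeqs k₁ k₂ k₃ m hx, ← Finset.card_filter, Finset.filter_mem_eq_inter,
      Finset.univ_inter]
  rw [← Nat.cast_sum, hsum, Nat.cast_sum, sum_descTriples, Nat.add_sub_cancel_left]
  push_cast
  ring
end
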